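/- arXiv:2004.05210 — 4 statements merged into one kernel-verified Lean document; each statement's English description precedes it below -/
import Mathlib

section
/- Let n ≥ 7 and a ∈ ℕ⁺, and set α = (n² − 3n + 8)/(3n² − 9n + 12), β = 4/(3n² − 9n + 12), and γ = (1/C(n−2,2))·(−1 + 4(n−2)²/(3n² − 9n + 12)). Then every union-closed family 𝒮 ⊆ 2^{[n]} in which every element of [n] belongs to at most a sets of 𝒮 satisfies |𝒮| ≤ n·a·α + 3·C(n,3)·β + 3·C(n,4)·γ + 1 (an inequality of rational numbers). -/
/-- A family of subsets of `[n]` (modeled as `Fin n`) is union-closed if it is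
closed under pairwise unions. -/
def UnionClosed {n : ℕ} (𝒮 : Finset (Finset (Fin n))) : Prop :=
  ∀ A ∈ 𝒮, ∀ B ∈ 𝒮, A ∪ B ∈ 𝒮

section

open Finset

variable {ι M : Type*} [Fintype ι] [DecidableEq ι] [AddCommMonoid M]

/-- Summing over ordered pairs of disjoint sets does not depend on which set is chosen first. -/
lemma sum_powersetCard_compl_comm (p q : ℕ) (f : Finset ι → Finset ι → M) :
    ∑ A ∈ powersetCard p univ, ∑ B ∈ powersetCard q Aᶜ, f A B =
      ∑ B ∈ powersetCard q univ, ∑ A ∈ powersetCard p Bᶜ, f A B := by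
  refine sum_comm' fun A B => ?_
  simp only [mem_powersetCard, subset_univ, true_and, subset_compl_comm (s := A)]
  tauto

/-- An ordered pair of disjoint sets is the same as a set together with a subset of it. -/
lemma sum_powersetCard_compl_union (p q : ℕ) (f : Finset ι → M) :
    ∑ A ∈ powersetCard p univ, ∑ B ∈ powersetCard q Aᶜ, f (A ∪ B) =
      (p + q).choose p • ∑ C ∈ powersetCard (p + q) univ, f C := by
  have hcount : (p + q).choose p • ∑ C ∈ powersetCard (p + q) univ, f C =
      ∑ C ∈ powersetCard (p + q) (univ : Finset ι), ∑ _A ∈ powersetCard p C, f C := by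
    rw [smul_sum]
    refine sum_congr rfl fun C hC => ?_
    rw [sum_const, card_powersetCard, (mem_powersetCard.1 hC).2]
  rw [hcount, sum_sigma', sum_sigma']
  refine sum_bij' (fun x _ => ⟨x.1 ∪ x.2, x.1⟩) (fun x _ => ⟨x.2, x.1 \ x.2⟩) ?_ ?_ ?_ ?_ ?_
  · rintro ⟨A, B⟩ h
    simp only [mem_sigma, mem_powersetCard, subset_univ, true_and] at h ⊢
    have hd : Disjoint A B := (subset_compl_iff_disjoint_left.1 h.2.1)
    exact ⟨by rw [card_union_of_disjoint hd, h.1, h.2.2], subset_union_left, h.1⟩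
  · rintro ⟨C, A⟩ h
    simp only [mem_sigma, mem_powersetCard, subset_univ, true_and] at h ⊢
    refine ⟨h.2.2, subset_compl_iff_disjoint_left.2 disjoint_sdiff, ?_⟩
    rw [card_sdiff_of_subset h.2.1, h.1, h.2.2, Nat.add_sub_cancel_left]
  · rintro ⟨A, B⟩ h
    simp only [mem_sigma, mem_powersetCard, subset_univ, true_and] at h
    have hd : Disjoint A B := (subset_compl_iff_disjoint_left.1 h.2.1)
    simp [union_sdiff_cancel_left hd]
  · rintro ⟨C, A⟩ h
    simp only [mem_sigma, mem_powersetCard, subset_univ, true_and] at h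
    simp [union_sdiff_of_subset h.2.1]
  · simp

lemma sum_powersetCard_compl_const (p q : ℕ) (f : Finset ι → M) :
    ∑ A ∈ powersetCard p univ, ∑ _B ∈ powersetCard q Aᶜ, f A =
      (Fintype.card ι - p).choose q • ∑ A ∈ powersetCard p univ, f A := by
  rw [smul_sum]
  refine sum_congr rfl fun A hA => ?_
  rw [sum_const, card_powersetCard, card_compl, (mem_powersetCard.1 hA).2]

lemma sum_powersetCard_ite_mem (𝒮 : Finset (Finset ι)) (k : ℕ) :
    ∑ A ∈ powersetCard k univ, (if A ∈ 𝒮 then 1 else 0) = #{A ∈ 𝒮 | #A = k} := by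
  rw [← card_filter]
  congr 1
  ext A
  simp [mem_powersetCard, and_comm]

/-- Summing `1_A + 1_B ≤ 1 + 1_{A ∪ B}` over all pairs of disjoint sets of sizes `p` and `q`. -/
lemma UnionClosed.card_filter_card_le {n : ℕ} {𝒮 : Finset (Finset (Fin n))} (h𝒮 : UnionClosed 𝒮)
    (p q : ℕ) :
    (n - p).choose q * #{A ∈ 𝒮 | #A = p} + (n - q).choose p * #{A ∈ 𝒮 | #A = q} ≤
      (p + q).choose p * (n.choose (p + q) + #{A ∈ 𝒮 | #A = p + q}) := by
  have hsum : ∑ A ∈ powersetCard p (univ : Finset (Fin n)), ∑ B ∈ powersetCard q Aᶜ,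
        ((if A ∈ 𝒮 then 1 else 0) + (if B ∈ 𝒮 then 1 else 0)) ≤
      ∑ A ∈ powersetCard p (univ : Finset (Fin n)), ∑ B ∈ powersetCard q Aᶜ,
        (1 + (if A ∪ B ∈ 𝒮 then 1 else 0)) := by
    refine sum_le_sum fun A _ => sum_le_sum fun B _ => ?_
    have := h𝒮 A
    grind
  simp only [sum_add_distrib] at hsum
  rw [sum_powersetCard_compl_const p q fun A => if A ∈ 𝒮 then 1 else 0,
    sum_powersetCard_compl_comm p q fun _ B => if B ∈ 𝒮 then 1 else 0,
    sum_powersetCard_compl_const q p fun B => if B ∈ 𝒮 then 1 else 0,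
    sum_powersetCard_compl_union p q fun _ => 1,
    sum_powersetCard_compl_union p q fun C => if C ∈ 𝒮 then 1 else 0] at hsum
  simp only [sum_powersetCard_ite_mem, sum_const, card_powersetCard, card_univ, Fintype.card_fin,
    smul_eq_mul, mul_one] at hsum
  rwa [mul_add]

end

theorem card_le_of_unionClosed_dual_bound
    (n a : ℕ) (hn : 7 ≤ n) (ha : 0 < a)
    (α β γ : ℚ)
    (hα : α = ((n : ℚ) ^ 2 - 3 * n + 8) / (3 * (n : ℚ) ^ 2 - 9 * n + 12))
    (hβ : β = 4 / (3 * (n : ℚ) ^ 2 - 9 * n + 12))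
    (hγ : γ = (1 / ((n - 2).choose 2 : ℚ)) *
        (-1 + 4 * ((n : ℚ) - 2) ^ 2 / (3 * (n : ℚ) ^ 2 - 9 * n + 12)))
    (𝒮 : Finset (Finset (Fin n))) (hUC : UnionClosed 𝒮)
    (hfreq : ∀ e : Fin n, (𝒮.filter (fun A => e ∈ A)).card ≤ a) :
    (𝒮.card : ℚ) ≤ n * a * α + 3 * (n.choose 3) * β + 3 * (n.choose 4) * γ + 1 := by
  have hn' : (7 : ℚ) ≤ n := by exact_mod_cast hn
  obtain ⟨D, hDn⟩ : ∃ D : ℚ, 3 * (n : ℚ) ^ 2 - 9 * n + 12 = D := ⟨_, rfl⟩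
  rw [hDn] at hα hβ hγ
  have hD : 0 < D := by nlinarith
  have hc1 : (((n - 1).choose 2 : ℕ) : ℚ) = ((n : ℚ) - 1) * (n - 2) / 2 := by
    rw [Nat.cast_choose_two, Nat.cast_sub (by omega)]
    push_cast
    ring
  have hc2 : (((n - 2).choose 2 : ℕ) : ℚ) = ((n : ℚ) - 2) * (n - 3) / 2 := by
    rw [Nat.cast_choose_two, Nat.cast_sub (by omega)]
    push_cast
    ring
  have hc2_pos : 0 < (((n - 2).choose 2 : ℕ) : ℚ) := by
    rw [hc2]
    nlinarith
  have hβ0 : 0 ≤ β := by rw [hβ]; positivity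
  have hcγ : ((n - 2).choose 2 : ℚ) * γ = ((n : ℚ) ^ 2 - 7 * n + 4) / D := by
    rw [hγ, ← mul_assoc, mul_one_div_cancel hc2_pos.ne']
    field_simp
    linarith
  have hγ0 : 0 ≤ γ := by
    refine nonneg_of_mul_nonneg_right (a := ((n - 2).choose 2 : ℚ)) ?_ hc2_pos
    rw [hcγ]
    exact div_nonneg (by nlinarith) hD.le
  have hγβ : γ ≤ β / 2 := by
    refine le_of_mul_le_mul_left (a := ((n - 2).choose 2 : ℚ)) ?_ hc2_pos
    rw [hcγ, hc2, hβ, ← sub_nonneg]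
    have : ((n : ℚ) - 2) * (n - 3) / 2 * (4 / D / 2) -
        ((n : ℚ) ^ 2 - 7 * n + 4) / D = (2 * n + 2) / D := by
      field_simp
      ring
    rw [this]
    positivity
  have hsize1 : α + ((n - 1).choose 2 : ℚ) * β = 1 := by
    rw [hc1, hα, hβ]
    field_simp
    linarith
  have hsize2 : 2 * α + ((n : ℚ) - 2) * β + ((n - 2).choose 2 : ℚ) * γ = 1 := by
    rw [hcγ, hα, hβ]
    field_simp
    linarith
  have hsize3 : 3 * α - 3 * β = 1 := by
    rw [hα, hβ]
    field_simp
    linarith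
  have hα0 : 0 ≤ α := by linarith
  have hweight : ∀ A ∈ 𝒮, (1 : ℚ) ≤ α * A.card
      + (if A.card = 0 then 1 else 0)
      + ((n - 1).choose 2 : ℚ) * β * (if A.card = 1 then 1 else 0)
      + (((n : ℚ) - 2) * β + ((n - 2).choose 2 : ℚ) * γ) * (if A.card = 2 then 1 else 0)
      - 3 * β * (if A.card = 3 then 1 else 0)
      - 3 * γ * (if A.card = 4 then 1 else 0) := by
    intro A _
    obtain h | h | h | h | h | h : A.card = 0 ∨ A.card = 1 ∨ A.card = 2 ∨ A.card = 3 ∨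
      A.card = 4 ∨ 5 ≤ A.card := by omega
    iterate 5
      simp only [h]
      norm_num
      try linarith
    have h5 : (5 : ℚ) ≤ A.card := by exact_mod_cast h
    rw [if_neg, if_neg, if_neg, if_neg, if_neg] <;> first | omega | nlinarith
  have htotal := Finset.sum_le_sum hweight
  simp only [Finset.sum_add_distrib, Finset.sum_sub_distrib, ← Finset.mul_sum,
    Finset.sum_boole, Finset.sum_const, nsmul_eq_mul, mul_one] at htotal
  have hdeg : (∑ A ∈ 𝒮, (A.card : ℚ)) ≤ n * a := by
    have := Finset.sum_card_le hfreq
    rw [Fintype.card_fin] at this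
    exact_mod_cast this
  have hempty : (((𝒮.filter fun A => A.card = 0).card : ℕ) : ℚ) ≤ 1 := by
    norm_cast
    refine Finset.card_le_one.2 fun A hA B hB => ?_
    simp_all
  have h12 : ((n - 1).choose 2 : ℚ) * (𝒮.filter fun A => A.card = 1).card +
      ((n : ℚ) - 2) * (𝒮.filter fun A => A.card = 2).card ≤
      3 * (n.choose 3 + (𝒮.filter fun A => A.card = 3).card) := by
    have := hUC.card_filter_card_le 1 2
    rw [Nat.choose_one_right, Nat.choose_one_right] at this
    have := (Nat.cast_le (α := ℚ)).2 this
    push_cast [Nat.cast_sub (show 2 ≤ n by omega)] at this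
    linarith
  have h22 : ((n - 2).choose 2 : ℚ) * (𝒮.filter fun A => A.card = 2).card ≤
      3 * (n.choose 4 + (𝒮.filter fun A => A.card = 4).card) := by
    have := hUC.card_filter_card_le 2 2
    rw [show Nat.choose (2 + 2) 2 = 6 from rfl] at this
    have := (Nat.cast_le (α := ℚ)).2 this
    push_cast at this
    linarith
  have := mul_le_mul_of_nonneg_left hdeg hα0
  have := mul_le_mul_of_nonneg_left h12 hβ0
  have := mul_le_mul_of_nonneg_left h22 hγ0
  linarith
end

section
/- Let a ≥ 7 be an integer and n ∈ ℕ⁺ be arbitrary. Then every union-closed family 𝒮 ⊆ 2^{[n]} in which every element of [n] belongs to at most a sets of 𝒮 satisfies 12·(a² − 3a + 4)·|𝒮| ≤ 5a⁴ − 12a³ + 31a² − 24a + 48. In particular, f(n,a) ≤ (5a⁴ − 12a³ + 31a² − 24a + 48)/(12(a² − 3a + 4)). -/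
/-- Twice the total size of all subsets of `X` is `|X| * 2 ^ |X|`. -/
theorem two_mul_sum_powerset_card {α : Type*} [DecidableEq α] (X : Finset α) :
    2 * ∑ T ∈ X.powerset, T.card = X.card * 2 ^ X.card := by
  have h : ∑ T ∈ X.powerset, T.card = ∑ T ∈ X.powerset, (X \ T).card :=
    Finset.sum_nbij' (fun T => X \ T) (fun T => X \ T)
      (by intro T _; simp) (by intro T _; simp)
      (by intro T hT; simpa using Finset.mem_powerset.mp hT)
      (by intro T hT; simpa using Finset.mem_powerset.mp hT)
      (by
        intro T hT
        rw [Finset.sdiff_sdiff_eq_self (Finset.mem_powerset.mp hT)])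
  rw [two_mul]
  nth_rewrite 2 [h]
  rw [← Finset.sum_add_distrib, Finset.sum_congr rfl (g := fun _ => X.card), Finset.sum_const,
    Finset.card_powerset, smul_eq_mul, mul_comm]
  intro T hT
  have := Finset.card_sdiff_add_card_eq_card (Finset.mem_powerset.mp hT)
  omega

/-- A minimal set meeting every nonempty member of `𝒮` meets each of its points privately. -/
theorem exists_transversal_forall_inter_eq_singleton {α : Type*} [Fintype α] [DecidableEq α]
    (𝒮 : Finset (Finset α)) :
    ∃ X : Finset α, (∀ A ∈ 𝒮, A.Nonempty → (A ∩ X).Nonempty) ∧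
      ∀ x ∈ X, ∃ A ∈ 𝒮, A ∩ X = {x} := by
  obtain ⟨X, hX⟩ := exists_minimal_of_wellFoundedLT
    (fun X : Finset α => ∀ A ∈ 𝒮, A.Nonempty → (A ∩ X).Nonempty)
    ⟨Finset.univ, fun A _ hA => by simpa using hA⟩
  refine ⟨X, hX.prop, fun x hx => ?_⟩
  have hnot := hX.not_prop_of_lt (Finset.erase_ssubset hx)
  push Not at hnot
  obtain ⟨A, hA, hne, hempty⟩ := hnot
  refine ⟨A, hA, (Finset.Nonempty.subset_singleton_iff (hX.prop A hA hne)).mp fun y hy => ?_⟩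
  by_contra hyx
  have : y ∈ A ∩ X.erase x := by
    rw [Finset.mem_inter] at hy
    exact Finset.mem_inter.mpr
      ⟨hy.1, Finset.mem_erase.mpr ⟨fun h => hyx (Finset.mem_singleton.mpr h), hy.2⟩⟩
  simp [hempty] at this

/-- A union-closed family whose traces on `X` contain all singletons has every nonempty subset
of `X` as a trace. -/
theorem UnionClosed.exists_inter_eq {n : ℕ} {𝒮 : Finset (Finset (Fin n))} (hUC : UnionClosed 𝒮)
    {X : Finset (Fin n)} (hX : ∀ x ∈ X, ∃ A ∈ 𝒮, A ∩ X = {x})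
    {T : Finset (Fin n)} (hT : T.Nonempty) (hTX : T ⊆ X) : ∃ A ∈ 𝒮, A ∩ X = T := by
  induction hT using Finset.Nonempty.cons_induction with
  | singleton x => exact hX x (hTX (Finset.mem_singleton_self x))
  | cons x T hx hT ih =>
    rw [Finset.cons_eq_insert, Finset.insert_subset_iff] at hTX
    obtain ⟨A, hA, hAX⟩ := hX x hTX.1
    obtain ⟨B, hB, hBX⟩ := ih hTX.2
    exact ⟨A ∪ B, hUC A hA B hB, by
      rw [Finset.union_inter_distrib_right, hAX, hBX, Finset.cons_eq_insert, Finset.insert_eq]⟩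

/-- A sharpening of Knill's bound: for some `k`, the size of a union-closed family with element
frequencies at most `a` is at most `k * a - (k - 2) * 2 ^ (k - 1)`. -/
theorem UnionClosed.exists_two_mul_card_le {n a : ℕ} {𝒮 : Finset (Finset (Fin n))}
    (hUC : UnionClosed 𝒮) (hfreq : ∀ e : Fin n, (𝒮.filter (fun A => e ∈ A)).card ≤ a) :
    ∃ k : ℕ, 2 * 𝒮.card + k * 2 ^ k ≤ 2 * (k * a) + 2 * 2 ^ k := by
  obtain ⟨X, hmeet, hsingle⟩ := exists_transversal_forall_inter_eq_singleton 𝒮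
  refine ⟨X.card, ?_⟩
  have htrace : ∀ T ∈ X.powerset.erase ∅, ∃ A ∈ 𝒮, A ∩ X = T := fun T hT => by
    rw [Finset.mem_erase, Finset.mem_powerset] at hT
    exact hUC.exists_inter_eq hsingle (Finset.nonempty_iff_ne_empty.mpr hT.1) hT.2
  choose! r hr hrX using htrace
  have hexcess : ∑ T ∈ X.powerset.erase ∅, ((T.card : ℤ) - 1) ≤
      ∑ A ∈ 𝒮.erase ∅, (((A ∩ X).card : ℤ) - 1) := by
    have hinj : Set.InjOn r (X.powerset.erase ∅ : Finset (Finset (Fin n))) :=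
      fun T hT U hU h => by rw [← hrX T hT, ← hrX U hU, h]
    calc ∑ T ∈ X.powerset.erase ∅, ((T.card : ℤ) - 1)
        = ∑ A ∈ (X.powerset.erase ∅).image r, (((A ∩ X).card : ℤ) - 1) := by
          rw [Finset.sum_image hinj]
          exact Finset.sum_congr rfl fun T hT => by rw [hrX T hT]
      _ ≤ ∑ A ∈ 𝒮.erase ∅, (((A ∩ X).card : ℤ) - 1) := by
          refine Finset.sum_le_sum_of_subset_of_nonneg ?_ fun A hA _ => ?_
          · intro A hA
            obtain ⟨T, hT, rfl⟩ := Finset.mem_image.mp hA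
            refine Finset.mem_erase.mpr ⟨fun h => ?_, hr T hT⟩
            have hTX := hrX T hT
            rw [h, Finset.empty_inter] at hTX
            exact (Finset.mem_erase.mp hT).1 hTX.symm
          · rw [Finset.mem_erase] at hA
            have := (hmeet A hA.2 (Finset.nonempty_iff_ne_empty.mpr hA.1)).card_pos
            omega
  have hcount : ∑ A ∈ 𝒮.erase ∅, (A ∩ X).card ≤ X.card * a := by
    calc ∑ A ∈ 𝒮.erase ∅, (A ∩ X).card
        ≤ ∑ A ∈ 𝒮, (A ∩ X).card := Finset.sum_le_sum_of_subset (Finset.erase_subset _ _)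
      _ = ∑ A ∈ 𝒮, (X ∩ A).card := by simp_rw [Finset.inter_comm]
      _ ≤ X.card * a := Finset.sum_card_inter_le fun x _ => hfreq x
  have hpow := two_mul_sum_powerset_card X
  rw [← Finset.sum_erase X.powerset Finset.card_empty] at hpow
  have hcard := Finset.card_erase_add_one (Finset.empty_mem_powerset X)
  rw [Finset.card_powerset] at hcard
  have hle : 𝒮.card ≤ (𝒮.erase ∅).card + 1 := by
    have := Finset.pred_card_le_card_erase (s := 𝒮) (a := ∅)
    omega
  simp only [Finset.sum_sub_distrib, Finset.sum_const, nsmul_eq_mul, mul_one] at hexcess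
  zify at *
  linarith

theorem two_mul_sq_add_two_mul_two_pow_le {k : ℕ} (hk : 4 ≤ k) :
    2 * k ^ 2 + 2 * 2 ^ k ≤ k * 2 ^ k := by
  induction k, hk using Nat.le_induction with
  | base => norm_num
  | succ k hk ih =>
    rw [pow_succ 2 k]
    nlinarith [Nat.zero_le (2 ^ k)]

theorem unionClosed_card_upper_bound
    (a n : ℕ) (ha : 7 ≤ a) (hn : 0 < n)
    (𝒮 : Finset (Finset (Fin n))) (hUC : UnionClosed 𝒮)
    (hfreq : ∀ e : Fin n, (𝒮.filter (fun A => e ∈ A)).card ≤ a) :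
    12 * ((a : ℤ) ^ 2 - 3 * a + 4) * 𝒮.card ≤
      5 * (a : ℤ) ^ 4 - 12 * a ^ 3 + 31 * a ^ 2 - 24 * a + 48 := by
  obtain ⟨k, hk⟩ := hUC.exists_two_mul_card_le hfreq
  have ha' : (7 : ℤ) ≤ a := by exact_mod_cast ha
  have hquad : 12 * (𝒮.card : ℤ) ≤ 5 * (a : ℤ) ^ 2 + 3 * a + 20 := by
    rcases lt_or_ge k 4 with h | h
    · zify at hk
      interval_cases k <;> norm_num at hk <;> nlinarith
    · have hpow := two_mul_sq_add_two_mul_two_pow_le h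
      zify at hk hpow
      nlinarith [sq_nonneg (5 * (a : ℤ) - 6 * k)]
  nlinarith [mul_le_mul_of_nonneg_left hquad
    (by nlinarith : (0 : ℤ) ≤ (a : ℤ) ^ 2 - 3 * a + 4)]
end

section
/- Let 𝒮 ⊆ 2^{[n]} be a union-closed family and let ℳ = 2^{[n]} \ 𝒮 be the family of subsets of [n] not in 𝒮. Then the number of sets in ℳ is at least the number of elements of [n] covered by sets of ℳ: |ℳ| ≥ |⋃_{A ∈ ℳ} A|. -/
/-- A missing set `M` has at least `|N|` missing subsets meeting a given `N ⊆ M`. -/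
theorem UnionClosed.card_le_card_missing_meeting {n : ℕ} {𝒮 : Finset (Finset (Fin n))}
    (hUC : UnionClosed 𝒮) {M N : Finset (Fin n)} (hM : M ∉ 𝒮) (hN : N ⊆ M) :
    N.card ≤ ((Finset.univ \ 𝒮).filter fun A => A ⊆ M ∧ ¬ Disjoint A N).card := by
  classical
  obtain rfl | ⟨x, hx⟩ := N.eq_empty_or_nonempty
  · simp
  have h_erase : ∀ y ∈ M, {y} ∈ 𝒮 → M.erase y ∉ 𝒮 := fun y hy h₁ h₂ => by
    apply hM
    have h := hUC _ h₁ _ h₂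
    rwa [← Finset.insert_eq, Finset.insert_erase hy] at h
  refine Finset.card_le_card_of_injOn
    (fun y => if y = x then M else if {y} ∈ 𝒮 then M.erase y else {y}) ?_ ?_
  · intro y hy
    have hy : y ∈ N := hy
    simp only [Finset.coe_filter, Finset.mem_sdiff, Finset.mem_univ, true_and, Set.mem_ofPred_eq,
      Finset.not_disjoint_iff]
    split_ifs with h₁ h₂
    · exact ⟨hM, subset_rfl, x, hN hx, hx⟩
    · exact ⟨h_erase y (hN hy) h₂, Finset.erase_subset _ _, x,
        Finset.mem_erase.2 ⟨Ne.symm h₁, hN hx⟩, hx⟩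
    · exact ⟨h₂, Finset.singleton_subset_iff.2 (hN hy), y, Finset.mem_singleton_self y, hy⟩
  · intro y hy z hz h
    have hxM := hN hx
    have hyM := hN hy
    have hzM := hN hz
    have h_x := Finset.ext_iff.1 h x
    have h_y := Finset.ext_iff.1 h y
    have h_z := Finset.ext_iff.1 h z
    dsimp only at h_x h_y h_z
    split_ifs at h_x h_y h_z <;>
      simp only [Finset.mem_erase, Finset.mem_singleton] at h_x h_y h_z <;> grind

/-- The union of any collection of missing sets contains at least as many missing sets as
elements. -/
theorem UnionClosed.card_biUnion_le_card_missing_subsets {n : ℕ} {𝒮 : Finset (Finset (Fin n))}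
    (hUC : UnionClosed 𝒮) (T : Finset (Finset (Fin n))) (hT : ∀ M ∈ T, M ∉ 𝒮) :
    (T.biUnion id).card ≤ ((Finset.univ \ 𝒮).filter fun A => A ⊆ T.biUnion id).card := by
  classical
  induction T using Finset.induction_on with
  | empty => simp
  | insert M T _ ih =>
    have h₁ := ih fun A hA => hT A (Finset.mem_insert_of_mem hA)
    rw [Finset.biUnion_insert, id_eq]
    set U := T.biUnion id
    have h₂ := hUC.card_le_card_missing_meeting (hT M (Finset.mem_insert_self M T))
      (Finset.sdiff_subset (s := M) (t := U))
    rw [← Finset.card_sdiff_add_card M U]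
    refine (add_le_add h₂ h₁).trans ?_
    rw [← Finset.card_union_of_disjoint]
    · refine Finset.card_le_card fun A hA => ?_
      simp only [Finset.mem_union, Finset.mem_filter] at hA ⊢
      rcases hA with ⟨hA, h, -⟩ | ⟨hA, h⟩
      · exact ⟨hA, h.trans Finset.subset_union_left⟩
      · exact ⟨hA, h.trans Finset.subset_union_right⟩
    · refine Finset.disjoint_left.2 fun A hA hA' => (Finset.mem_filter.1 hA).2.2 ?_
      exact Finset.disjoint_of_subset_left (Finset.mem_filter.1 hA').2 Finset.disjoint_sdiff

/-- The complement `ℳ = 2^{[n]} \ 𝒮` of a union-closed family has at least as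
many sets as the number of elements covered by its sets. -/
theorem missing_sets_cover
    {n : ℕ} (𝒮 : Finset (Finset (Fin n))) (hUC : UnionClosed 𝒮) :
    ((Finset.univ \ 𝒮).biUnion id).card ≤ (Finset.univ \ 𝒮).card := by
  exact (hUC.card_biUnion_le_card_missing_subsets _ fun M hM => (Finset.mem_sdiff.1 hM).2).trans
    (Finset.card_le_card (Finset.filter_subset _ _))
end

section
/- Let n ∈ ℕ⁺ and let i be an integer with 0 ≤ i ≤ n − 1. Then every union-closed family 𝒮 ⊆ 2^{[n]} with |𝒮| = 2ⁿ − i contains an element e ∈ [n] that belongs to at least 2^{n−1} sets of 𝒮. -/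
/-- In a union-closed family, an inclusion-minimal non-member `X` containing `x` has the property
that every other point of `X` has its singleton outside the family, while `{x}` is inside. -/
theorem UnionClosed.exists_notMem_singleton {n : ℕ} {𝒮 : Finset (Finset (Fin n))}
    (hUC : UnionClosed 𝒮) {x : Fin n} (hx : ∃ X, x ∈ X ∧ X ∉ 𝒮) :
    ∃ X, X ∉ 𝒮 ∧ x ∈ X ∧ ∀ y ∈ X, y ≠ x → {y} ∉ 𝒮 ∧ {x} ∈ 𝒮 := by
  obtain ⟨X, ⟨hxX, hX⟩, hmin⟩ :=
    exists_minimal_of_wellFoundedLT (fun X : Finset (Fin n) => x ∈ X ∧ X ∉ 𝒮) hx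
  have mem_of_ssubset : ∀ Y, x ∈ Y → Y ⊂ X → Y ∈ 𝒮 := fun Y hxY hYX => by
    by_contra hY
    exact hYX.2 (hmin ⟨hxY, hY⟩ hYX.1)
  refine ⟨X, hX, hxX, fun y hy hyx => ⟨fun hyS => hX ?_, ?_⟩⟩
  · have h := hUC _ hyS _
      (mem_of_ssubset _ (Finset.mem_erase.2 ⟨hyx.symm, hxX⟩) (Finset.erase_ssubset hy))
    rwa [← Finset.insert_eq, Finset.insert_erase hy] at h
  · refine mem_of_ssubset _ (Finset.mem_singleton_self x)
      ⟨Finset.singleton_subset_iff.2 hxX, fun h => hyx (Finset.mem_singleton.1 (h hy))⟩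

/-- If every element lies in a non-member of a union-closed family on `[n]`, then the family has
at least `n` non-members. -/
theorem UnionClosed.le_card_compl {n : ℕ} {𝒮 : Finset (Finset (Fin n))} (hUC : UnionClosed 𝒮)
    (h : ∀ x, ∃ X, x ∈ X ∧ X ∉ 𝒮) : n ≤ 𝒮ᶜ.card := by
  choose f hfS hxf hf using fun x => hUC.exists_notMem_singleton (h x)
  have hinj : Function.Injective f := fun x y hxy => by
    by_contra hne
    exact (hf x y (hxy ▸ hxf y) (Ne.symm hne)).1 (hf y x (hxy ▸ hxf x) hne).2
  simpa using Finset.card_le_card_of_injOn (s := Finset.univ) f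
    (fun x _ => by simpa using hfS x) hinj.injOn

/-- A family containing every set through `e` has at least `2 ^ (n - 1)` members through `e`. -/
theorem two_pow_pred_le_card_filter_mem {n : ℕ} {𝒮 : Finset (Finset (Fin n))} {e : Fin n}
    (h : ∀ X, e ∈ X → X ∈ 𝒮) : 2 ^ (n - 1) ≤ (𝒮.filter (fun A => e ∈ A)).card := by
  have hcard : (Finset.univ.erase e).powerset.card = 2 ^ (n - 1) := by simp
  rw [← hcard]
  refine Finset.card_le_card_of_injOn (insert e)
    (fun A _ => by simpa using h _ (Finset.mem_insert_self e A)) fun A hA B hB hAB => ?_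
  have notMem : ∀ C ∈ (Finset.univ.erase e).powerset, e ∉ C := fun C hC heC =>
    Finset.notMem_erase e _ (Finset.mem_powerset.1 hC heC)
  rw [← Finset.erase_insert (notMem A hA), ← Finset.erase_insert (notMem B hB)]
  exact congrArg (Finset.erase · e) hAB

/-- A union-closed family on `[n]` with `2^n - i` sets, `0 ≤ i ≤ n - 1`, has an
element in at least `2^(n-1)` of its sets. -/
theorem large_unionClosed_has_frequent_element
    (n i : ℕ) (hn : 0 < n) (hi : i ≤ n - 1)
    (𝒮 : Finset (Finset (Fin n))) (hUC : UnionClosed 𝒮)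
    (hcard : 𝒮.card = 2 ^ n - i) :
    ∃ e : Fin n, 2 ^ (n - 1) ≤ (𝒮.filter (fun A => e ∈ A)).card := by
  by_contra! hlt
  have hn_le := hUC.le_card_compl fun x => by
    by_contra! hx
    exact (two_pow_pred_le_card_filter_mem hx).not_gt (hlt x)
  rw [Finset.card_compl, Fintype.card_finset, Fintype.card_fin, hcard] at hn_le
  omega
end
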